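/- Let H be a finite, nonempty class of measurable hypotheses h : X → Y, l the zero-one loss, p* a probability distribution over X × Y, and assume realisability (there exists h* ∈ H with L(h*) = 0). Let ĥ be any empirical risk minimiser. Fix ε > 0 and δ ∈ (0,1). If the number of i.i.d. training samples satisfies n ≥ (log|H| + log(1/δ))/ε, then the probability that L(ĥ) > ε is at most δ. -/

import Mathlib

open MeasureTheory Real

variable {X Y : Type*} [MeasurableSpace X] [MeasurableSpace Y]

/-- Expected risk of a hypothesis `h : X → Y` under the zero-one loss, for a data
distribution `p` on `X × Y`: `L(h) = p {(x,y) : h x ≠ y}`. -/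
noncomputable def expectedRisk01 (p : Measure (X × Y)) (h : X → Y) : ℝ :=
  (p {z : X × Y | h z.1 ≠ z.2}).toReal

/-- Empirical risk of a hypothesis `h : X → Y` under the zero-one loss, for a training
set `D = ((x₁,y₁),…,(xₙ,yₙ))`: `L̂(h) = (1/n) ∑ᵢ 1[h xᵢ ≠ yᵢ]`. -/
noncomputable def empiricalRisk01 {n : ℕ} (D : Fin n → X × Y) (h : X → Y) : ℝ :=
  (n : ℝ)⁻¹ * ∑ i, ({z : X × Y | h z.1 ≠ z.2}).indicator (fun _ => (1 : ℝ)) (D i)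

/-- The probability that `n` independent samples all avoid an event of probability more than `ε`
is at most `exp (-ε n)`. -/
theorem measureReal_pi_forall_notMem_le_exp {Z : Type*} [MeasurableSpace Z] {n : ℕ}
    (p : Measure Z) [IsProbabilityMeasure p] {E : Set Z} (hE : MeasurableSet E) {ε : ℝ}
    (hε : ε ≤ p.real E) :
    (Measure.pi fun _ : Fin n => p).real {D | ∀ i, D i ∉ E} ≤ Real.exp (-(ε * n)) := by
  have hset : {D : Fin n → Z | ∀ i, D i ∉ E} = Set.univ.pi fun _ => Eᶜ := by
    ext D
    simp
  rw [hset, measureReal_def, Measure.pi_pi, ENNReal.toReal_prod, Finset.prod_const,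
    Finset.card_univ, Fintype.card_fin, ← measureReal_def, probReal_compl_eq_one_sub hE]
  calc (1 - p.real E) ^ n ≤ Real.exp (-ε) ^ n :=
        pow_le_pow_left₀ (sub_nonneg.2 measureReal_le_one)
          (by linarith [Real.add_one_le_exp (-ε)]) n
    _ = Real.exp (-(ε * n)) := by
        rw [← Real.exp_nat_mul]
        ring_nf

/-- Independent samples almost surely all avoid a null event. -/
theorem ae_pi_forall_notMem {Z : Type*} [MeasurableSpace Z] {n : ℕ}
    (p : Measure Z) [IsProbabilityMeasure p] {E : Set Z} (hE : p E = 0) :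
    ∀ᵐ D ∂(Measure.pi fun _ : Fin n => p), ∀ i, D i ∉ E :=
  ae_all_iff.2 fun _ => Measure.tendsto_eval_ae_ae.eventually (measure_eq_zero_iff_ae_notMem.1 hE)

/-- A hypothesis has nonpositive empirical risk exactly when it fits every sample. -/
theorem empiricalRisk01_nonpos_iff {U V : Type*} {n : ℕ} (D : Fin n → U × V) (h : U → V) :
    empiricalRisk01 D h ≤ 0 ↔ ∀ i, D i ∉ {z : U × V | h z.1 ≠ z.2} := by
  have hnonneg : ∀ i ∈ Finset.univ,
      0 ≤ ({z : U × V | h z.1 ≠ z.2}).indicator (fun _ => (1 : ℝ)) (D i) :=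
    fun i _ => Set.indicator_nonneg (fun _ _ => zero_le_one) _
  unfold empiricalRisk01
  rcases Nat.eq_zero_or_pos n with rfl | hn
  · simp
  · have hn' : (0 : ℝ) < (n : ℝ)⁻¹ := by positivity
    rw [← not_lt, mul_pos_iff_of_pos_left hn', not_lt, (Finset.sum_nonneg hnonneg).ge_iff_eq',
      Finset.sum_eq_zero_iff_of_nonneg hnonneg]
    simp

/-- **Sample complexity for finite, realisable hypothesis classes.**
Under realisability, for `ε > 0` and `δ ∈ (0,1)`, if the number `n` of i.i.d. training samples
satisfies `n ≥ (log |H| + log (1/δ)) / ε`, then the probability that the empirical risk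
minimiser `ĥ` has expected risk `L(ĥ) > ε` is at most `δ`. -/
theorem sample_complexity_finite_realisable
    {n : ℕ}
    (H : Finset (X → Y)) (hH : H.Nonempty)
    (hmeas : ∀ h ∈ H, Measurable h ∧ MeasurableSet {z : X × Y | h z.1 ≠ z.2})
    (p : Measure (X × Y)) [IsProbabilityMeasure p]
    (hrealisable : ∃ h ∈ H, expectedRisk01 p h = 0)
    (erm : (Fin n → X × Y) → X → Y)
    (herm : ∀ D : Fin n → X × Y,
      erm D ∈ H ∧ ∀ h ∈ H, empiricalRisk01 D (erm D) ≤ empiricalRisk01 D h)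
    (ε : ℝ) (hε : 0 < ε) (δ : ℝ) (hδ : δ ∈ Set.Ioo (0 : ℝ) 1)
    (hsamples : (Real.log H.card + Real.log (1 / δ)) / ε ≤ n) :
    ((Measure.pi fun _ : Fin n => p) {D | ε < expectedRisk01 p (erm D)}).toReal ≤ δ := by
  obtain ⟨g, hgH, hg⟩ := hrealisable
  obtain ⟨hδ0, -⟩ := hδ
  have hcard : (0 : ℝ) < H.card := by exact_mod_cast hH.card_pos
  let μ := Measure.pi fun _ : Fin n => p
  let err (h : X → Y) : Set (X × Y) := {z | h z.1 ≠ z.2}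
  let bad := {h ∈ H | ε < expectedRisk01 p h}
  have hnull : p (err g) = 0 := (measureReal_eq_zero_iff).1 hg
  have hsub : {D | ε < expectedRisk01 p (erm D)} ≤ᵐ[μ] ⋃ h ∈ bad, {D | ∀ i, D i ∉ err h} := by
    filter_upwards [ae_pi_forall_notMem p hnull] with D hD hlt
    have hfit := (empiricalRisk01_nonpos_iff D (erm D)).1
      (((herm D).2 g hgH).trans ((empiricalRisk01_nonpos_iff D g).2 hD))
    exact Set.mem_biUnion (Finset.mem_filter.2 ⟨(herm D).1, hlt⟩) hfit
  have hexp : Real.exp (-(ε * n)) ≤ δ / H.card := by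
    rw [div_le_iff₀ hε, one_div, Real.log_inv] at hsamples
    rw [← Real.le_log_iff_exp_le (by positivity), Real.log_div hδ0.ne' hcard.ne']
    linarith
  calc μ.real {D | ε < expectedRisk01 p (erm D)}
      ≤ μ.real (⋃ h ∈ bad, {D | ∀ i, D i ∉ err h}) :=
        ENNReal.toReal_mono (measure_ne_top _ _) (measure_mono_ae hsub)
    _ ≤ ∑ h ∈ bad, μ.real {D | ∀ i, D i ∉ err h} := measureReal_biUnion_finset_le _ _
    _ ≤ ∑ _h ∈ bad, δ / H.card := Finset.sum_le_sum fun h hh => by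
        obtain ⟨hhH, hlt⟩ := Finset.mem_filter.1 hh
        exact (measureReal_pi_forall_notMem_le_exp p (hmeas h hhH).2 hlt.le).trans hexp
    _ ≤ H.card * (δ / H.card) := by
        rw [Finset.sum_const, nsmul_eq_mul]
        gcongr
        exact Finset.filter_subset _ _
    _ = δ := mul_div_cancel₀ _ hcard.ne'
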